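/- arXiv:1708.07086 — 8 statements merged into one kernel-verified Lean document; each statement's English description precedes it below -/
import Mathlib

section
/- If f : ℝ → ℝ is three times continuously differentiable with compact support, then for every x ∈ ℝ, A_n f(x) → −θ(x + b/a)·f′(x) + (θ/(2a²))·f″(x) as n → ∞. -/
/-- The operator `A_n = (θ/2)·n·(T_n − I)` of the rescaled Laplace–Bernoulli urn chain,
applied to `f` at the point `x`. -/
noncomputable def ouA (a b θ : ℝ) (n : ℕ) (f : ℝ → ℝ) (x : ℝ) : ℝ :=
  (θ / 2) * (n : ℝ) *
    ((1 - (1/2) * (1 + (a*x + b) / Real.sqrt n))^2 * f (x + 2 / (a * Real.sqrt n))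
      + (1 + (a*x + b) / Real.sqrt n) * (1 - (1/2) * (1 + (a*x + b) / Real.sqrt n)) * f x
      + ((1/2) * (1 + (a*x + b) / Real.sqrt n))^2 * f (x - 2 / (a * Real.sqrt n))
      - f x)

open Filter Topology in
theorem taylor_two_aux (f : ℝ → ℝ) (hf : ContDiff ℝ 3 f) (x : ℝ) :
    Tendsto (fun y => (f y - (f x + deriv f x * (y - x) + deriv (deriv f) x / 2 * (y - x)^2))
      / (y - x)^2) (𝓝 x) (𝓝 0) := by
  have h2 : ContDiff ℝ (2 : ℕ) f := hf.of_le (by norm_num)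
  have h := (taylor_isLittleO_univ (x₀ := x) h2).tendsto_div_nhds_zero
  refine h.congr fun y => ?_
  congr 2
  simp only [taylorWithinEval_succ, taylor_within_zero_eval, iteratedDerivWithin_univ,
    iteratedDeriv_succ, iteratedDeriv_zero, smul_eq_mul]
  norm_num
  ring

open Filter Topology in
theorem stmt_1 (a b θ : ℝ) (ha : a ≠ 0) (hθ : 0 < θ)
    (f : ℝ → ℝ) (hf : ContDiff ℝ 3 f) (hsupp : HasCompactSupport f) (x : ℝ) :
    Filter.Tendsto (fun n : ℕ => ouA a b θ n f x) Filter.atTop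
      (nhds (-θ * (x + b / a) * deriv f x + (θ / (2 * a^2)) * deriv (deriv f) x)) := by
  have hT := taylor_two_aux f hf x
  set r : ℝ → ℝ := fun y =>
    (f y - (f x + deriv f x * (y - x) + deriv (deriv f) x / 2 * (y - x)^2)) / (y - x)^2 with hr
  have hs : Tendsto (fun n : ℕ => (Real.sqrt n)⁻¹) atTop (𝓝 0) :=
    tendsto_inv_atTop_zero.comp (Real.tendsto_sqrt_atTop.comp tendsto_natCast_atTop_atTop)
  have hp : Tendsto (fun n : ℕ => x + 2 / a * (Real.sqrt n)⁻¹) atTop (𝓝 x) := by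
    simpa using (hs.const_mul (2 / a)).const_add x
  have hm : Tendsto (fun n : ℕ => x - 2 / a * (Real.sqrt n)⁻¹) atTop (𝓝 x) := by
    simpa using (hs.const_mul (2 / a)).const_sub x
  have hrp := hT.comp hp
  have hrm := hT.comp hm
  have hq : Tendsto (fun n : ℕ => (1/2) * (1 + (a*x+b) * (Real.sqrt n)⁻¹)) atTop (𝓝 (1/2)) := by
    simpa using ((hs.const_mul (a*x+b)).const_add 1).const_mul (1/2 : ℝ)
  have hq' : Tendsto (fun n : ℕ => 1 - (1/2) * (1 + (a*x+b) * (Real.sqrt n)⁻¹)) atTop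
      (𝓝 (1 - 1/2)) := hq.const_sub 1
  have key := (((((hq'.pow 2).add (hq.pow 2)).mul_const (θ / a^2 * deriv (deriv f) x)).const_add
    (-θ * (x + b / a) * deriv f x)).add
    ((((hq'.pow 2).mul hrp).add ((hq.pow 2).mul hrm)).const_mul (2 * θ / a^2)))
  have e : -θ * (x + b / a) * deriv f x +
      ((1 - 1/2)^2 + (1/2)^2) * (θ / a^2 * deriv (deriv f) x) +
      2 * θ / a^2 * ((1 - 1/2)^2 * 0 + (1/2)^2 * 0) =
      -θ * (x + b / a) * deriv f x + (θ / (2 * a^2)) * deriv (deriv f) x := by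
    field_simp
    ring
  rw [e] at key
  refine key.congr' ?_
  filter_upwards [eventually_gt_atTop 0] with n hn
  have hn' : (0 : ℝ) < n := by exact_mod_cast hn
  have hsn : Real.sqrt n ≠ 0 := (Real.sqrt_pos.2 hn').ne'
  have hsq : (n : ℝ) = Real.sqrt n ^ 2 := (Real.sq_sqrt hn'.le).symm
  have e1 : 2 / (a * Real.sqrt n) = 2 / a * (Real.sqrt n)⁻¹ := by field_simp
  have hne : 2 / a * (Real.sqrt n)⁻¹ ≠ 0 := by positivity
  have hexp : ∀ h : ℝ, h ≠ 0 → f (x + h) =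
      f x + deriv f x * h + deriv (deriv f) x / 2 * h^2 + r (x + h) * h^2 := by
    intro h hh
    simp only [hr, add_sub_cancel_left]
    field_simp
    ring
  have hP := hexp _ hne
  have hM := hexp _ (neg_ne_zero.2 hne)
  rw [← sub_eq_add_neg] at hM
  simp only [ouA, Function.comp_apply]
  rw [e1, hP, hM]
  generalize r (x + 2 / a * (Real.sqrt n)⁻¹) = R1
  generalize r (x - 2 / a * (Real.sqrt n)⁻¹) = R2
  clear_value r
  generalize Real.sqrt n = s at *
  rw [hsq]
  field_simp
  ring
end

section
/- If f : ℝ → ℝ is three times continuously differentiable with compact support, then sup_{x ∈ ℝ} | A_n f(x) − ( −θ(x + b/a)·f′(x) + (θ/(2a²))·f″(x) ) | → 0 as n → ∞, i.e. the convergence of A_n f to the Ornstein–Uhlenbeck generator applied to f is uniform on ℝ. -/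
lemma aux_step (g g' : ℝ → ℝ) (k : ℕ) (C : ℝ) (hC : 0 ≤ C) (h0 : g 0 = 0)
    (hd : ∀ t, HasDerivAt g (g' t) t) (hb : ∀ t, |g' t| ≤ C * |t| ^ k) (t : ℝ) :
    |g t| ≤ C * |t| ^ (k + 1) := by
  have h := (convex_Icc (-|t|) |t|).norm_image_sub_le_of_norm_hasDerivWithin_le
    (f := g) (f' := g') (C := C * |t| ^ k) (x := 0) (y := t)
    (fun u _ => (hd u).hasDerivWithinAt)
    (fun u hu => (hb u).trans (by
      have : |u| ≤ |t| := abs_le.2 hu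
      gcongr))
    ⟨by simp, by simp⟩ ⟨neg_abs_le t, le_abs_self t⟩
  simp only [h0, sub_zero, Real.norm_eq_abs] at h
  rw [pow_succ, ← mul_assoc]
  exact h

lemma aux_taylor (f : ℝ → ℝ) (hf : ContDiff ℝ 3 f) (hsupp : HasCompactSupport f) :
    ∃ C, 0 ≤ C ∧ ∀ x t, |f (x + t) - f x - deriv f x * t - deriv (deriv f) x * (t ^ 2 / 2)|
      ≤ C * |t| ^ 3 := by
  have hf1 : ContDiff ℝ 2 (deriv f) := ((contDiff_succ_iff_deriv (n := 2)).1 hf).2.2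
  have hf2 : ContDiff ℝ 1 (deriv (deriv f)) := ((contDiff_succ_iff_deriv (n := 1)).1 hf1).2.2
  have d0 : ∀ x, HasDerivAt f (deriv f x) x := fun x =>
    (hf.differentiable (by norm_num) x).hasDerivAt
  have d1 : ∀ x, HasDerivAt (deriv f) (deriv (deriv f) x) x := fun x =>
    (hf1.differentiable (by norm_num) x).hasDerivAt
  have d2 : ∀ x, HasDerivAt (deriv (deriv f)) (deriv (deriv (deriv f)) x) x := fun x =>
    (hf2.differentiable (by norm_num) x).hasDerivAt
  obtain ⟨C, hC⟩ := (hsupp.deriv.deriv.deriv).exists_bound_of_continuous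
    (hf2.continuous_deriv (by norm_num))
  have hC0 : 0 ≤ C := (norm_nonneg _).trans (hC 0)
  refine ⟨C, hC0, fun x => ?_⟩
  have s2 := aux_step (fun t => deriv (deriv f) (x + t) - deriv (deriv f) x)
    (fun t => deriv (deriv (deriv f)) (x + t)) 0 C hC0 (by simp)
    (fun t => ((d2 (x + t)).comp_const_add x t).sub_const _)
    (fun t => by simpa using hC (x + t))
  have s1 := aux_step (fun t => deriv f (x + t) - deriv f x - deriv (deriv f) x * t)
    _ 1 C hC0 (by simp)
    (fun t => by
      have := (((d1 (x + t)).comp_const_add x t).sub_const (deriv f x)).sub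
        ((hasDerivAt_id t).const_mul (deriv (deriv f) x))
      simp at this
      exact this) s2
  have s0 := aux_step
    (fun t => f (x + t) - f x - deriv f x * t - deriv (deriv f) x * (t ^ 2 / 2))
    _ 2 C hC0 (by simp)
    (fun t => by
      have := ((((d0 (x + t)).comp_const_add x t).sub_const (f x)).sub
        ((hasDerivAt_id t).const_mul (deriv f x))).sub
        ((((hasDerivAt_id t).pow 2).div_const 2).const_mul (deriv (deriv f) x))
      simp at this
      exact this) s1
  exact s0

lemma aux_core (a b θ x s F Fp Fm D E C M B : ℝ) (ha : a ≠ 0) (hθ : 0 < θ) (hs : 1 ≤ s)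
    (hB : |a * x + b| ≤ B) (hE : |E| ≤ M) (hC : 0 ≤ C)
    (hp : |Fp - F - D * (2 / (a * s)) - E * ((2 / (a * s)) ^ 2 / 2)| ≤ C * |2 / (a * s)| ^ 3)
    (hm : |Fm - F - D * (-(2 / (a * s))) - E * ((-(2 / (a * s))) ^ 2 / 2)|
      ≤ C * |-(2 / (a * s))| ^ 3) :
    |(θ / 2) * s ^ 2 *
    ((1 - (1/2) * (1 + (a*x + b) / s))^2 * Fp
      + (1 + (a*x + b) / s) * (1 - (1/2) * (1 + (a*x + b) / s)) * F
      + ((1/2) * (1 + (a*x + b) / s))^2 * Fm - F)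
      - (-θ * (x + b / a) * D + (θ / (2 * a^2)) * E)|
    ≤ (θ / (2 * a ^ 2) * B ^ 2 * M + 2 * θ * (1 + B ^ 2) * C / |a| ^ 3) / s := by
  have hs0 : 0 < s := by linarith
  have ha0 : 0 < |a| := abs_pos.2 ha
  have hM : 0 ≤ M := (abs_nonneg _).trans hE
  set rp := Fp - F - D * (2 / (a * s)) - E * ((2 / (a * s)) ^ 2 / 2) with hrp
  set rm := Fm - F - D * (-(2 / (a * s))) - E * ((-(2 / (a * s))) ^ 2 / 2) with hrm
  set y := (a * x + b) / s with hy
  have hyB : y ^ 2 ≤ B ^ 2 / s ^ 2 := by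
    rw [hy, div_pow]
    gcongr ?_ / _
    rw [← sq_abs]; gcongr
  have hs2 : 1 ≤ s ^ 2 := by nlinarith
  have hyB' : y ^ 2 ≤ B ^ 2 := hyB.trans (div_le_self (sq_nonneg B) hs2)
  have hh : |2 / (a * s)| ^ 3 = 8 / (|a| ^ 3 * s ^ 3) := by
    rw [abs_div, abs_mul, abs_of_pos hs0, div_pow, mul_pow]; norm_num
  rw [abs_neg] at hm
  rw [hh] at hp hm
  have key : (θ / 2) * s ^ 2 *
    ((1 - (1/2) * (1 + y))^2 * Fp + (1 + y) * (1 - (1/2) * (1 + y)) * F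
      + ((1/2) * (1 + y))^2 * Fm - F) - (-θ * (x + b / a) * D + (θ / (2 * a^2)) * E)
      = θ / (2 * a ^ 2) * y ^ 2 * E
        + (θ / 2) * s ^ 2 * ((1 - (1/2) * (1 + y))^2 * rp + ((1/2) * (1 + y))^2 * rm) := by
    rw [hrp, hrm, hy]; field_simp; ring
  rw [key]
  have h1 : |θ / (2 * a ^ 2) * y ^ 2 * E| ≤ θ / (2 * a ^ 2) * B ^ 2 * M / s := by
    rw [abs_mul, abs_of_nonneg (by positivity : 0 ≤ θ / (2 * a ^ 2) * y ^ 2)]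
    calc _ ≤ θ / (2 * a ^ 2) * (B ^ 2 / s ^ 2) * M := by gcongr
      _ = θ / (2 * a ^ 2) * B ^ 2 * M / s ^ 2 := by ring
      _ ≤ _ := by
        gcongr
        nlinarith
  have h2 : |(1 - (1/2) * (1 + y))^2 * rp + ((1/2) * (1 + y))^2 * rm|
      ≤ (1 + B ^ 2) / 2 * (C * (8 / (|a| ^ 3 * s ^ 3))) := by
    set Q := C * (8 / (|a| ^ 3 * s ^ 3))
    have hQ : 0 ≤ Q := by positivity
    calc _ ≤ |(1 - (1/2) * (1 + y))^2 * rp| + |((1/2) * (1 + y))^2 * rm| := abs_add_le _ _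
      _ = (1 - (1/2) * (1 + y))^2 * |rp| + ((1/2) * (1 + y))^2 * |rm| := by
        rw [abs_mul, abs_mul, abs_of_nonneg (sq_nonneg (1 - (1/2) * (1 + y))),
          abs_of_nonneg (sq_nonneg ((1/2) * (1 + y)))]
      _ ≤ (1 - (1/2) * (1 + y))^2 * Q + ((1/2) * (1 + y))^2 * Q := by gcongr
      _ = (1 + y ^ 2) / 2 * Q := by ring
      _ ≤ _ := by gcongr
  calc _ ≤ |θ / (2 * a ^ 2) * y ^ 2 * E| + |(θ / 2) * s ^ 2 *
        ((1 - (1/2) * (1 + y))^2 * rp + ((1/2) * (1 + y))^2 * rm)| := abs_add_le _ _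
    _ ≤ θ / (2 * a ^ 2) * B ^ 2 * M / s
        + (θ / 2) * s ^ 2 * ((1 + B ^ 2) / 2 * (C * (8 / (|a| ^ 3 * s ^ 3)))) := by
      rw [abs_mul ((θ / 2) * s ^ 2), abs_of_nonneg (by positivity : 0 ≤ (θ / 2) * s ^ 2)]
      gcongr
    _ = _ := by field_simp; ring


/-- If `f : ℝ → ℝ` is three times continuously differentiable with compact
support, then `sup_{x ∈ ℝ} |A_n f(x) − (−θ(x + b/a)·f′(x) + (θ/(2a²))·f″(x))| → 0`
as `n → ∞`, i.e. `A_n f` converges uniformly on `ℝ` to the Ornstein–Uhlenbeck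
generator applied to `f`. -/
theorem stmt_2 (a b θ : ℝ) (ha : a ≠ 0) (hθ : 0 < θ)
    (f : ℝ → ℝ) (hf : ContDiff ℝ 3 f) (hsupp : HasCompactSupport f) :
    TendstoUniformly (fun (n : ℕ) (x : ℝ) => ouA a b θ n f x)
      (fun x : ℝ => -θ * (x + b / a) * deriv f x + (θ / (2 * a^2)) * deriv (deriv f) x)
      Filter.atTop := by
  obtain ⟨C, hC, hT⟩ := aux_taylor f hf hsupp
  have hf1 : ContDiff ℝ 2 (deriv f) := ((contDiff_succ_iff_deriv (n := 2)).1 hf).2.2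
  obtain ⟨M, hM⟩ := (hsupp.deriv.deriv).exists_bound_of_continuous
    (hf1.continuous_deriv (by norm_num))
  obtain ⟨R, hR⟩ := hsupp.isCompact.isBounded.exists_norm_le
  have z0 : ∀ x, R < |x| → f x = 0 := fun x hx => by
    by_contra h
    exact absurd (hR x (subset_tsupport f h)) (not_le.2 hx)
  have z1 : ∀ x, R < |x| → deriv f x = 0 := fun x hx => by
    by_contra h
    exact absurd (hR x (support_deriv_subset h)) (not_le.2 hx)
  have z2 : ∀ x, R < |x| → deriv (deriv f) x = 0 := fun x hx => by
    by_contra h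
    exact absurd (hR x (tsupport_deriv_subset (support_deriv_subset h))) (not_le.2 hx)
  set B := |a| * (R + 2 / |a|) + |b| with hB
  set K := θ / (2 * a ^ 2) * B ^ 2 * M + 2 * θ * (1 + B ^ 2) * C / |a| ^ 3 with hK
  have hM0 : 0 ≤ M := (norm_nonneg _).trans (hM 0)
  have hK0 : 0 ≤ K := by positivity
  have ha0 : 0 < |a| := abs_pos.2 ha
  have hlim : Filter.Tendsto (fun n : ℕ => K / Real.sqrt n) Filter.atTop (nhds 0) :=
    Filter.Tendsto.div_atTop tendsto_const_nhds
      (Real.tendsto_sqrt_atTop.comp tendsto_natCast_atTop_atTop)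
  rw [Metric.tendstoUniformly_iff]
  intro ε hε
  filter_upwards [hlim.eventually (gt_mem_nhds hε), Filter.eventually_ge_atTop 1] with n hn h1 x
  refine lt_of_le_of_lt ?_ hn
  have hs : 1 ≤ Real.sqrt n := Real.one_le_sqrt.2 (by exact_mod_cast h1)
  have hs0 : 0 < Real.sqrt n := by linarith
  have hsq : (n : ℝ) = Real.sqrt n ^ 2 := (Real.sq_sqrt (Nat.cast_nonneg n)).symm
  rw [dist_comm, Real.dist_eq]
  by_cases hx : |x| ≤ R + 2 / |a|
  · have := aux_core a b θ x (Real.sqrt n) (f x) (f (x + 2 / (a * Real.sqrt n)))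
      (f (x - 2 / (a * Real.sqrt n))) (deriv f x) (deriv (deriv f) x) C M B ha hθ hs
      (by
        refine (abs_add_le _ _).trans ?_
        rw [abs_mul, hB]
        gcongr) (hM x) hC (hT x _) (hT x (-(2 / (a * Real.sqrt n))))
    rw [← hsq] at this
    exact this
  · push Not at hx
    have hh : |2 / (a * Real.sqrt n)| ≤ 2 / |a| := by
      rw [abs_div, abs_mul, abs_of_pos hs0, abs_two]
      gcongr
      exact le_mul_of_one_le_right ha0.le hs
    have hpos : 0 < 2 / |a| := by positivity
    have hp : f (x + 2 / (a * Real.sqrt n)) = 0 := z0 _ (by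
      have := abs_sub_abs_le_abs_sub x (-(2 / (a * Real.sqrt n)))
      rw [abs_neg, sub_neg_eq_add] at this
      linarith)
    have hm : f (x - 2 / (a * Real.sqrt n)) = 0 := z0 _ (by
      have := abs_sub_abs_le_abs_sub x (2 / (a * Real.sqrt n))
      linarith)
    have e : ouA a b θ n f x = 0 := by
      unfold ouA
      rw [hp, hm, z0 x (by linarith)]
      ring
    rw [e, z1 x (by linarith), z2 x (by linarith)]
    simp only [mul_zero, add_zero, sub_zero, abs_zero]
    positivity
end

section
/- For every n ∈ ℕ, the hypergeometric distribution π_i = C(n,i)·C(n,n−i)/C(2n,n), 0 ≤ i ≤ n, is a stationary distribution for the Laplace urn Markov chain: for every y ∈ {0,1,…,n}, ∑_{x=0}^{n} π_x · p_{x,y} = π_y. -/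
/-- One-step transition probabilities of the Laplace urn Markov chain on `{0,1,…,n}`:
`p_{x,x+1} = (1 − x/n)²`, `p_{x,x} = 2(x/n)(1 − x/n)`, `p_{x,x−1} = (x/n)²`,
and `p_{x,y} = 0` otherwise. -/
noncomputable def laplaceP (n x y : ℕ) : ℝ :=
  if y = x + 1 then (1 - (x : ℝ) / n)^2
  else if y = x then 2 * ((x : ℝ) / n) * (1 - (x : ℝ) / n)
  else if y + 1 = x then ((x : ℝ) / n)^2
  else 0

/-- The hypergeometric distribution `π_i = C(n,i)·C(n,n−i)/C(2n,n)` on `{0,1,…,n}`. -/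
noncomputable def hypergeomPi (n i : ℕ) : ℝ :=
  ((n.choose i : ℝ) * (n.choose (n - i) : ℝ)) / ((2 * n).choose n : ℝ)

/-- Detailed balance between neighbouring states. -/
theorem laplace_adj (n x : ℕ) (hn : 1 ≤ n) (hx : x + 1 ≤ n) :
    hypergeomPi n x * (1 - (x : ℝ) / n)^2 = hypergeomPi n (x + 1) * (((x + 1 : ℕ) : ℝ) / n)^2 := by
  have h : (n.choose (x + 1) : ℝ) * ((x : ℝ) + 1) = n.choose x * ((n : ℝ) - x) := by
    have h1 := Nat.choose_succ_right_eq n x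
    have h2 : ((n - x : ℕ) : ℝ) = (n : ℝ) - x := Nat.cast_sub (by omega)
    rw [← h2]
    exact_mod_cast h1
  have hn0 : (n : ℝ) ≠ 0 := by
    have : n ≠ 0 := by omega
    exact_mod_cast this
  have e : (1 - (x : ℝ) / n) = ((n : ℝ) - x) / n := by field_simp
  unfold hypergeomPi
  rw [Nat.choose_symm hx, Nat.choose_symm (by omega : x ≤ n), e]
  push_cast
  calc _ = ((n.choose x : ℝ) * ((n : ℝ) - x))^2 / (((2 * n).choose n : ℝ) * n^2) := by ring
    _ = _ := by rw [← h]; ring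

/-- Detailed balance. -/
theorem laplace_balance (n x y : ℕ) (hn : 1 ≤ n) (hx : x ≤ n) (hy : y ≤ n) :
    hypergeomPi n x * laplaceP n x y = hypergeomPi n y * laplaceP n y x := by
  unfold laplaceP
  by_cases h1 : y = x + 1
  · subst h1
    simpa [show ¬ (x = x + 1 + 1) by omega] using laplace_adj n x hn hy
  · by_cases h2 : x = y + 1
    · subst h2
      simpa [show ¬ (y = y + 1 + 1) by omega] using (laplace_adj n y hn hx).symm
    · by_cases h3 : y = x
      · subst h3; rfl
      · rw [if_neg h1, if_neg h3, if_neg (by omega), if_neg h2, if_neg (by omega),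
          if_neg (by omega)]
        simp

/-- The rows of the transition matrix sum to one. -/
theorem laplace_row (n y : ℕ) (hn : 1 ≤ n) (hy : y ≤ n) :
    ∑ x ∈ Finset.range (n + 1), laplaceP n y x = 1 := by
  have hn0 : (n : ℝ) ≠ 0 := by
    have : n ≠ 0 := by omega
    exact_mod_cast this
  have e : ∀ x, laplaceP n y x = (if x = y + 1 then (1 - (y : ℝ) / n)^2 else 0)
      + (if x = y then 2 * ((y : ℝ) / n) * (1 - (y : ℝ) / n) else 0)
      + (if x = y - 1 then ((y : ℝ) / n)^2 else 0) := by
    intro x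
    unfold laplaceP
    rcases Nat.eq_zero_or_pos y with h0 | h0
    · subst h0
      by_cases h1 : x = 1 <;> by_cases h2 : x = 0 <;> simp_all
    · have : x + 1 = y ↔ x = y - 1 := by omega
      simp only [this]
      split_ifs <;> first | omega | simp
  simp only [e, Finset.sum_add_distrib, Finset.sum_ite_eq', Finset.mem_range]
  rw [if_pos (by omega : y < n + 1), if_pos (by omega : y - 1 < n + 1)]
  by_cases h : y = n
  · subst h
    simp [hn0]
  · rw [if_pos (by omega)]
    ring

/-- For every `n`, the hypergeometric distribution
`π_i = C(n,i)·C(n,n−i)/C(2n,n)`, `0 ≤ i ≤ n`, is a stationary distribution for the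
Laplace urn Markov chain: for every `y ∈ {0,1,…,n}`,
`∑_{x=0}^{n} π_x · p_{x,y} = π_y`. -/
theorem stmt_5 (n : ℕ) (hn : 1 ≤ n) (y : ℕ) (hy : y ≤ n) :
    ∑ x ∈ Finset.range (n + 1), hypergeomPi n x * laplaceP n x y = hypergeomPi n y := by
  rw [Finset.sum_congr rfl (fun x hx =>
    laplace_balance n x y hn (by have := Finset.mem_range.1 hx; omega) hy),
    ← Finset.mul_sum, laplace_row n y hn hy, mul_one]
end

section
/- In the Jacobi–Wright–Fisher scheme, the scaled conditional second moment converges: (1/n)·∑_{j=0}^{n} C(n,j)·p_n^j·(1−p_n)^{n−j}·(j − i_n)² → y·(1 − y) as n → ∞. -/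
/-- Initial state `i_n = ⌊n·y⌋` of the Jacobi–Wright–Fisher chain. -/
noncomputable def jacI (y : ℝ) (n : ℕ) : ℕ := ⌊(n : ℝ) * y⌋₊

/-- Expected fraction of A-types `p_n = (i_n/n)(1 − a/n) + (1 − i_n/n)(b/n)` in the
Wright–Fisher model with mutation rates `α = a/n`, `β = b/n` and no selection. -/
noncomputable def jacP (a b y : ℝ) (n : ℕ) : ℝ :=
  ((jacI y n : ℝ) / n) * (1 - a / n) + (1 - (jacI y n : ℝ) / n) * (b / n)

theorem binom_second_moment (n : ℕ) (p i : ℝ) :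
    ∑ j ∈ Finset.range (n + 1),
      (n.choose j : ℝ) * p ^ j * (1 - p) ^ (n - j) * ((j : ℝ) - i) ^ 2 =
      n * p * (1 - p) + (n * p - i) ^ 2 := by
  have h0 := congrArg (Polynomial.eval p) (bernsteinPolynomial.sum ℝ n)
  have h1 := congrArg (Polynomial.eval p) (bernsteinPolynomial.sum_smul ℝ n)
  have h2 := congrArg (Polynomial.eval p) (bernsteinPolynomial.variance ℝ n)
  simp [Polynomial.eval_finsetSum, bernsteinPolynomial] at h0 h1 h2
  have key : ∀ j ∈ Finset.range (n + 1),
      (n.choose j : ℝ) * p ^ j * (1 - p) ^ (n - j) * ((j : ℝ) - i) ^ 2 =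
      (n * p - j) ^ 2 * ((n.choose j : ℝ) * p ^ j * (1 - p) ^ (n - j)) +
      (2 * (n * p - i)) * (j * ((n.choose j : ℝ) * p ^ j * (1 - p) ^ (n - j))) +
      (i ^ 2 - (n * p) ^ 2) * ((n.choose j : ℝ) * p ^ j * (1 - p) ^ (n - j)) := by
    intro j _
    ring
  rw [Finset.sum_congr rfl key, Finset.sum_add_distrib, Finset.sum_add_distrib,
    ← Finset.mul_sum, ← Finset.mul_sum, h0, h1, h2]
  ring

/-- In the Jacobi–Wright–Fisher scheme, the scaled conditional second
moment converges:
`(1/n)·∑_{j=0}^{n} C(n,j)·p_n^j·(1−p_n)^{n−j}·(j − i_n)² → y·(1 − y)` as `n → ∞`. -/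
theorem stmt_10 (a b : ℝ) (ha : 0 < a) (hb : 0 < b)
    (y : ℝ) (hy : y ∈ Set.Icc (0 : ℝ) 1) :
    Filter.Tendsto (fun n : ℕ =>
        (1 / (n : ℝ)) * ∑ j ∈ Finset.range (n + 1),
          (n.choose j : ℝ) * (jacP a b y n) ^ j * (1 - jacP a b y n) ^ (n - j) *
            ((j : ℝ) - (jacI y n : ℝ)) ^ 2)
      Filter.atTop (nhds (y * (1 - y))) := by
  have hx : Filter.Tendsto (fun n : ℕ => (jacI y n : ℝ) / n) Filter.atTop (nhds y) := by
    have h := (tendsto_nat_floor_mul_div_atTop hy.1).comp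
      (tendsto_natCast_atTop_atTop (R := ℝ))
    refine h.congr fun n => ?_
    simp [jacI, mul_comm]
  have ha0 : Filter.Tendsto (fun n : ℕ => a / (n : ℝ)) Filter.atTop (nhds 0) :=
    tendsto_const_div_atTop_nhds_zero_nat a
  have hb0 : Filter.Tendsto (fun n : ℕ => b / (n : ℝ)) Filter.atTop (nhds 0) :=
    tendsto_const_div_atTop_nhds_zero_nat b
  have h10 : Filter.Tendsto (fun n : ℕ => 1 / (n : ℝ)) Filter.atTop (nhds 0) :=
    tendsto_const_div_atTop_nhds_zero_nat 1
  have hp : Filter.Tendsto (fun n : ℕ => jacP a b y n) Filter.atTop (nhds y) := by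
    have h := (hx.mul (ha0.const_sub 1)).add ((hx.const_sub 1).mul hb0)
    simpa [jacP] using h
  have hd := ((hx.const_sub 1).mul_const b).sub (hx.mul_const a)
  have hall := (hp.mul (hp.const_sub 1)).add (h10.mul (hd.pow 2))
  rw [zero_mul, add_zero] at hall
  refine hall.congr' ?_
  filter_upwards [Filter.eventually_gt_atTop 0] with n hn
  have hn' : (n : ℝ) ≠ 0 := by exact_mod_cast hn.ne'
  rw [binom_second_moment]
  have e : (n : ℝ) * jacP a b y n - jacI y n =
      (1 - (jacI y n : ℝ) / n) * b - (jacI y n : ℝ) / n * a := by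
    unfold jacP
    field_simp
    ring
  rw [e]
  field_simp
end

section
/- Let f : ℝ → ℝ be three times continuously differentiable with compact support, θ > 0. Then for every y ∈ [0,1], θn·∑_{j=0}^{n} C(n,j)·p_n^j·(1−p_n)^{n−j}·( f(j/n) − f(i_n/n) ) → θ·(b − (a+b)y)·f′(y) + (θ/2)·y(1−y)·f″(y) as n → ∞; equivalently, writing γ = θ(a+b), δ = 1/(2(a+b)), μ = b/(a+b), the limit is −γ(y − μ)·f′(y) + (1/2)(2γδ)·y(1−y)·f″(y), the Jacobi diffusion generator applied to f. -/
/-- Binomial expectation. -/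
noncomputable def binE (n : ℕ) (p : ℝ) (g : ℕ → ℝ) : ℝ :=
  ∑ j ∈ Finset.range (n + 1), (n.choose j : ℝ) * p ^ j * (1 - p) ^ (n - j) * g j

lemma binE_succ (n : ℕ) (p : ℝ) (g : ℕ → ℝ) :
    binE (n + 1) p g = binE n p (fun j => p * g (j + 1) + (1 - p) * g j) := by
  have h2 : ∑ j ∈ Finset.range (n + 1 + 1),
      (n.choose j : ℝ) * p ^ j * (1 - p) ^ (n + 1 - j) * g j
      = ∑ j ∈ Finset.range (n + 1),
        (n.choose j : ℝ) * p ^ j * (1 - p) ^ (n - j) * ((1 - p) * g j) := by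
    rw [Finset.sum_range_succ]
    simp only [Nat.choose_succ_self, Nat.cast_zero, zero_mul, add_zero]
    refine Finset.sum_congr rfl fun j hj => ?_
    have : n + 1 - j = (n - j) + 1 := by
      have := Finset.mem_range.1 hj
      omega
    rw [this, pow_succ]; ring
  unfold binE
  simp only [mul_add, Finset.sum_add_distrib]
  rw [← h2, Finset.sum_range_succ', Finset.sum_range_succ' _ (n + 1), ← add_assoc,
    ← Finset.sum_add_distrib]
  congr 1
  · refine Finset.sum_congr rfl fun j hj => ?_
    rw [Nat.choose_succ_succ, Nat.add_sub_add_right, pow_succ]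
    push_cast; ring
  · simp

lemma binE_add (n : ℕ) (p : ℝ) (g h : ℕ → ℝ) :
    binE n p (fun j => g j + h j) = binE n p g + binE n p h := by
  simp [binE, mul_add, Finset.sum_add_distrib]

lemma binE_smul (n : ℕ) (p c : ℝ) (g : ℕ → ℝ) :
    binE n p (fun j => c * g j) = c * binE n p g := by
  unfold binE
  rw [Finset.mul_sum]
  exact Finset.sum_congr rfl fun j _ => by ring

lemma binE_mono (n : ℕ) (p : ℝ) (h0 : 0 ≤ p) (h1 : p ≤ 1) (g h : ℕ → ℝ)
    (hgh : ∀ j, g j ≤ h j) : binE n p g ≤ binE n p h := by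
  unfold binE
  have : 0 ≤ 1 - p := by linarith
  exact Finset.sum_le_sum fun j _ => mul_le_mul_of_nonneg_left (hgh j) (by positivity)

lemma binE_one (n : ℕ) (p : ℝ) : binE n p (fun _ => 1) = 1 := by
  induction n with
  | zero => simp [binE]
  | succ n ih => rw [binE_succ]; simpa using ih

lemma binE_const (n : ℕ) (p c : ℝ) : binE n p (fun _ => c) = c := by
  have := binE_smul n p c (fun _ => 1)
  simpa [binE_one] using this

lemma binE_m1 (n : ℕ) (p : ℝ) : binE n p (fun j => (j : ℝ) - n * p) = 0 := by
  induction n with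
  | zero => simp [binE]
  | succ n ih =>
    rw [binE_succ, ← ih]; congr 1; ext j; push_cast; ring

lemma binE_m2 (n : ℕ) (p : ℝ) :
    binE n p (fun j => ((j : ℝ) - n * p) ^ 2) = n * (p * (1 - p)) := by
  induction n with
  | zero => simp [binE]
  | succ n ih =>
    have : (fun j : ℕ => p * (((j + 1 : ℕ) : ℝ) - ((n + 1 : ℕ) : ℝ) * p) ^ 2
        + (1 - p) * ((j : ℝ) - ((n + 1 : ℕ) : ℝ) * p) ^ 2)
        = fun j : ℕ => ((j : ℝ) - n * p) ^ 2 + p * (1 - p) := by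
      ext j; push_cast; ring
    rw [binE_succ, this, binE_add, ih, binE_const]; push_cast; ring

lemma binE_m4 (n : ℕ) (p : ℝ) :
    binE n p (fun j => ((j : ℝ) - n * p) ^ 4)
      = 3 * n * (n - 1) * (p * (1 - p)) ^ 2 + n * (p * (1 - p)) * (p ^ 3 + (1 - p) ^ 3) := by
  induction n with
  | zero => simp [binE]
  | succ n ih =>
    have : (fun j : ℕ => p * (((j + 1 : ℕ) : ℝ) - ((n + 1 : ℕ) : ℝ) * p) ^ 4
        + (1 - p) * ((j : ℝ) - ((n + 1 : ℕ) : ℝ) * p) ^ 4)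
        = fun j : ℕ => ((j : ℝ) - n * p) ^ 4 + (6 * (p * (1 - p)) * ((j : ℝ) - n * p) ^ 2
          + (4 * (p * (1 - p) * (1 - 2 * p)) * ((j : ℝ) - n * p)
          + p * (1 - p) * (p ^ 3 + (1 - p) ^ 3))) := by
      ext j; push_cast; ring
    rw [binE_succ, this, binE_add, ih, binE_add, binE_smul, binE_m2, binE_add, binE_smul,
      binE_m1, binE_const]; push_cast; ring

lemma binE_m4_le (n : ℕ) (hn : 1 ≤ n) (p : ℝ) (h0 : 0 ≤ p) (h1 : p ≤ 1) :
    binE n p (fun j => ((j : ℝ) - n * p) ^ 4) ≤ (n : ℝ) ^ 2 := by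
  rw [binE_m4]
  have hn' : (1 : ℝ) ≤ n := by exact_mod_cast hn
  have hv0 : 0 ≤ p * (1 - p) := mul_nonneg h0 (by linarith)
  have e : p ^ 3 + (1 - p) ^ 3 = 1 - 3 * (p * (1 - p)) := by ring
  rw [e]
  have hv1 : p * (1 - p) ≤ 1 / 4 := by nlinarith [sq_nonneg (p - 1 / 2)]
  generalize p * (1 - p) = v at *
  have a1 : v ^ 2 ≤ 1 / 16 := by nlinarith
  have a2 : 3 * (n : ℝ) * (n - 1) * v ^ 2 ≤ 3 * (n : ℝ) * (n - 1) * (1 / 16) :=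
    mul_le_mul_of_nonneg_left a1 (mul_nonneg (by linarith) (by linarith))
  have a3 : (n : ℝ) * v * (1 - 3 * v) ≤ n * (1 / 4) := by
    rw [mul_assoc]
    exact mul_le_mul_of_nonneg_left (by nlinarith) (by linarith)
  nlinarith

lemma pow_bound_aux (g g' : ℝ → ℝ) (x C : ℝ) (k : ℕ) (hC : 0 ≤ C) (hg : g x = 0)
    (hd : ∀ t, HasDerivAt g (g' t) t) (hb : ∀ t, |g' t| ≤ C * |t - x| ^ k) (z : ℝ) :
    |g z| ≤ C * |z - x| ^ (k + 1) := by
  have := Convex.norm_image_sub_le_of_norm_hasDerivWithin_le (f := g) (f' := g')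
    (C := C * |z - x| ^ k) (s := Set.uIcc x z) (x := x) (y := z)
    (fun t _ => (hd t).hasDerivWithinAt)
    (fun t ht => by
      refine (hb t).trans ?_
      have := Set.abs_sub_left_of_mem_uIcc ht
      gcongr)
    (convex_uIcc x z) Set.left_mem_uIcc Set.right_mem_uIcc
  rw [hg, sub_zero] at this
  simpa [Real.norm_eq_abs, pow_succ, mul_assoc] using this

lemma taylor3 (f : ℝ → ℝ) (hf : ContDiff ℝ 3 f) (hsupp : HasCompactSupport f) :
    ∃ M, 0 ≤ M ∧ ∀ x z, |f z - f x - deriv f x * (z - x)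
      - deriv (deriv f) x / 2 * (z - x) ^ 2| ≤ M * |z - x| ^ 3 := by
  have h1 : ContDiff ℝ 2 (deriv f) := hf.deriv'
  have h2 : ContDiff ℝ 1 (deriv (deriv f)) := h1.deriv'
  have h3 : Continuous (deriv (deriv (deriv f))) := h2.continuous_deriv (by norm_num)
  obtain ⟨M, hM⟩ := hsupp.deriv.deriv.deriv.exists_bound_of_continuous h3
  have d0 : ∀ t, HasDerivAt f (deriv f t) t := fun t =>
    (hf.differentiable (by norm_num) t).hasDerivAt
  have d1 : ∀ t, HasDerivAt (deriv f) (deriv (deriv f) t) t := fun t =>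
    (h1.differentiable (by norm_num) t).hasDerivAt
  have d2 : ∀ t, HasDerivAt (deriv (deriv f)) (deriv (deriv (deriv f)) t) t := fun t =>
    (h2.differentiable (by norm_num) t).hasDerivAt
  have hM0 : 0 ≤ M := (norm_nonneg _).trans (hM 0)
  refine ⟨M, hM0, fun x z => ?_⟩
  have b2 := pow_bound_aux (fun t => deriv (deriv f) t - deriv (deriv f) x) _ x M 0 hM0
    (by simp) (fun t => (d2 t).sub_const _) (fun t => by simpa using hM t)
  have b1 := pow_bound_aux (fun t => deriv f t - deriv f x - deriv (deriv f) x * (t - x))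
    (fun t => deriv (deriv f) t - deriv (deriv f) x) x M 1 hM0 (by simp)
    (fun t => by
      have := ((d1 t).sub_const (deriv f x)).sub
        (((hasDerivAt_id t).sub_const x).const_mul (deriv (deriv f) x))
      refine this.congr_deriv ?_
      simp) b2
  exact pow_bound_aux (fun t => f t - f x - deriv f x * (t - x)
      - deriv (deriv f) x / 2 * (t - x) ^ 2)
    (fun t => deriv f t - deriv f x - deriv (deriv f) x * (t - x)) x M 2 hM0 (by simp)
    (fun t => by
      have := (((d0 t).sub_const (f x)).sub
        (((hasDerivAt_id t).sub_const x).const_mul (deriv f x))).sub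
        ((((hasDerivAt_id t).sub_const x).pow 2).const_mul (deriv (deriv f) x / 2))
      refine this.congr_deriv ?_
      simp; ring) b1 z

lemma main_bound (f : ℝ → ℝ) (M : ℝ) (hM0 : 0 ≤ M)
    (hM : ∀ x z, |f z - f x - deriv f x * (z - x)
      - deriv (deriv f) x / 2 * (z - x) ^ 2| ≤ M * |z - x| ^ 3)
    (n : ℕ) (hn : 1 ≤ n) (p x c L : ℝ) (h0 : 0 ≤ p) (h1 : p ≤ 1) (hc : p = x + c / n)
    (hL : |c| ≤ L) :
    |n * binE n p (fun j => f ((j : ℝ) / n) - f x)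
      - (deriv f x * c + deriv (deriv f) x / 2 * (p * (1 - p) + c ^ 2 / n))|
      ≤ M * (8 * (1 + L ^ 4) + (1 + L ^ 2)) / Real.sqrt n := by
  have hn' : (1 : ℝ) ≤ n := by exact_mod_cast hn
  have hnp : (0 : ℝ) < n := by linarith
  set s := Real.sqrt n with hs
  have hsp : 0 < s := Real.sqrt_pos.2 hnp
  have hss : s ^ 2 = n := Real.sq_sqrt hnp.le
  have hL0 : 0 ≤ L := (abs_nonneg c).trans hL
  have hc2 : c ^ 2 ≤ L ^ 2 := by rw [← sq_abs c]; gcongr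
  have hc4 : c ^ 4 ≤ L ^ 4 := by
    have : c ^ 4 = |c| ^ 4 := by rw [Even.pow_abs (by decide)]
    rw [this]; gcongr
  have hu : ∀ j : ℕ, (j : ℝ) / n - x = (1 / n) * ((j : ℝ) - n * p) + c / n := by
    intro j; rw [hc]; field_simp; ring
  -- moments about `x`
  have e1 : binE n p (fun j => (j : ℝ) / n - x) = c / n := by
    simp only [hu]
    rw [binE_add, binE_smul, binE_m1, binE_const]; ring
  have e2 : binE n p (fun j => ((j : ℝ) / n - x) ^ 2) = p * (1 - p) / n + c ^ 2 / n ^ 2 := by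
    have : (fun j : ℕ => ((j : ℝ) / n - x) ^ 2) = fun j : ℕ =>
        (1 / (n : ℝ) ^ 2) * ((j : ℝ) - n * p) ^ 2
        + ((2 * c / n ^ 2) * ((j : ℝ) - n * p) + c ^ 2 / n ^ 2) := by
      ext j; rw [hu]; field_simp; ring
    rw [this, binE_add, binE_smul, binE_m2, binE_add, binE_smul, binE_m1, binE_const]
    field_simp; ring
  have e4 : binE n p (fun j => ((j : ℝ) / n - x) ^ 4) ≤ 8 * (1 + L ^ 4) / n ^ 2 := by
    have l1 : binE n p (fun j => ((j : ℝ) / n - x) ^ 4) ≤ binE n p (fun j : ℕ =>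
        (8 / (n : ℝ) ^ 4) * ((j : ℝ) - n * p) ^ 4 + 8 * c ^ 4 / n ^ 4) := by
      refine binE_mono n p h0 h1 _ _ fun j => ?_
      rw [hu]
      have k : ∀ u v : ℝ, (u + v) ^ 4 ≤ 8 * u ^ 4 + 8 * v ^ 4 := fun u v => by
        have q1 : (u + v) ^ 2 ≤ 2 * (u ^ 2 + v ^ 2) := by nlinarith [sq_nonneg (u - v)]
        have q2 : ((u + v) ^ 2) ^ 2 ≤ (2 * (u ^ 2 + v ^ 2)) ^ 2 := by gcongr
        nlinarith [sq_nonneg (u ^ 2 - v ^ 2)]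
      refine (k _ _).trans (le_of_eq ?_)
      field_simp
    refine l1.trans ?_
    rw [binE_add, binE_smul, binE_const]
    have l2 := binE_m4_le n hn p h0 h1
    calc _ ≤ 8 / (n : ℝ) ^ 4 * (n : ℝ) ^ 2 + 8 * L ^ 4 / n ^ 2 := by
          have : (n : ℝ) ^ 2 ≤ n ^ 4 := by gcongr <;> norm_num [hn']
          gcongr
      _ = _ := by field_simp
  have e3 : binE n p (fun j => |(j : ℝ) / n - x| ^ 3)
      ≤ s * (8 * (1 + L ^ 4) / n ^ 2) + (1 / s) * ((1 + L ^ 2) / n) := by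
    have l1 : binE n p (fun j => |(j : ℝ) / n - x| ^ 3) ≤ binE n p (fun j : ℕ =>
        s * ((j : ℝ) / n - x) ^ 4 + (1 / s) * ((j : ℝ) / n - x) ^ 2) := by
      refine binE_mono n p h0 h1 _ _ fun j => ?_
      generalize (j : ℝ) / n - x = u
      have q2 : u ^ 2 = |u| ^ 2 := (sq_abs u).symm
      have q4 : u ^ 4 = |u| ^ 4 := by rw [Even.pow_abs (by decide)]
      rw [q2, q4]
      have hw := abs_nonneg u
      generalize |u| = w at *
      have : s * w ^ 4 + 1 / s * w ^ 2 - w ^ 3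
          = w ^ 2 * ((s * w - 1 / 2) ^ 2 + 3 / 4) / s := by
        field_simp; ring
      have : 0 ≤ w ^ 2 * ((s * w - 1 / 2) ^ 2 + 3 / 4) / s := by positivity
      linarith
    refine l1.trans ?_
    rw [binE_add, binE_smul, binE_smul, e2]
    have hv : p * (1 - p) ≤ 1 := by nlinarith [sq_nonneg (p - 1 / 2)]
    have : p * (1 - p) / n + c ^ 2 / n ^ 2 ≤ (1 + L ^ 2) / n := by
      rw [add_div]
      have : (n : ℝ) ≤ n ^ 2 := by nlinarith
      gcongr
    gcongr
  -- decomposition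
  set R : ℕ → ℝ := fun j => f ((j : ℝ) / n) - f x - deriv f x * ((j : ℝ) / n - x)
      - deriv (deriv f) x / 2 * ((j : ℝ) / n - x) ^ 2 with hR
  have dec : binE n p (fun j => f ((j : ℝ) / n) - f x)
      = binE n p R + (deriv f x * (c / n)
        + deriv (deriv f) x / 2 * (p * (1 - p) / n + c ^ 2 / n ^ 2)) := by
    rw [← e2, ← e1, ← binE_smul, ← binE_smul, ← binE_add, ← binE_add]
    congr 1; ext j; simp only [hR]; ring
  have hRb : |binE n p R| ≤ M * (s * (8 * (1 + L ^ 4) / n ^ 2) + (1 / s) * ((1 + L ^ 2) / n)) := by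
    refine le_trans ?_ (mul_le_mul_of_nonneg_left e3 hM0)
    rw [← binE_smul, abs_le]
    constructor
    · have := binE_mono n p h0 h1 (fun j => (-1) * (M * |(j : ℝ) / n - x| ^ 3)) R
        (fun j => by have := (abs_le.1 (hM x ((j : ℝ) / n))).1; simp only [hR]; linarith)
      rw [binE_smul] at this; linarith
    · exact binE_mono n p h0 h1 _ _ fun j => (abs_le.1 (hM x ((j : ℝ) / n))).2
  have : n * binE n p (fun j => f ((j : ℝ) / n) - f x)
      - (deriv f x * c + deriv (deriv f) x / 2 * (p * (1 - p) + c ^ 2 / n))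
      = n * binE n p R := by
    rw [dec]; field_simp; ring
  rw [this, abs_mul, abs_of_pos hnp]
  refine (mul_le_mul_of_nonneg_left hRb hnp.le).trans (le_of_eq ?_)
  rw [← hss]; field_simp

/-- Let `f : ℝ → ℝ` be three times continuously differentiable with
compact support, `θ > 0`. Then for every `y ∈ [0,1]`,
`θn·∑_{j=0}^{n} C(n,j)·p_n^j·(1−p_n)^{n−j}·(f(j/n) − f(i_n/n))
  → θ·(b − (a+b)y)·f′(y) + (θ/2)·y(1−y)·f″(y)` as `n → ∞`;
with `γ = θ(a+b)`, `δ = 1/(2(a+b))`, `μ = b/(a+b)` the limit is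
`−γ(y − μ)·f′(y) + (1/2)(2γδ)·y(1−y)·f″(y)`, the Jacobi generator applied to `f`. -/
theorem stmt_12 (a b θ : ℝ) (ha : 0 < a) (hb : 0 < b) (hθ : 0 < θ)
    (f : ℝ → ℝ) (hf : ContDiff ℝ 3 f) (hsupp : HasCompactSupport f)
    (y : ℝ) (hy : y ∈ Set.Icc (0 : ℝ) 1) :
    Filter.Tendsto (fun n : ℕ =>
        θ * (n : ℝ) * ∑ j ∈ Finset.range (n + 1),
          (n.choose j : ℝ) * (jacP a b y n) ^ j * (1 - jacP a b y n) ^ (n - j) *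
            (f ((j : ℝ) / n) - f ((jacI y n : ℝ) / n)))
      Filter.atTop
      (nhds (θ * (b - (a + b) * y) * deriv f y
        + (θ / 2) * (y * (1 - y)) * deriv (deriv f) y)) := by
  obtain ⟨M, hM0, hM⟩ := taylor3 f hf hsupp
  obtain ⟨hy0, hy1⟩ := hy
  set x : ℕ → ℝ := fun n => (jacI y n : ℝ) / n with hx
  set c : ℕ → ℝ := fun n => b * (1 - x n) - a * x n with hc
  set p : ℕ → ℝ := fun n => jacP a b y n with hp
  have hpx : ∀ n, p n = x n + c n / n := fun n => by
    simp only [hp, hc, hx, jacP]; ring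
  have hx0 : ∀ n, 0 ≤ x n := fun n => by simp only [hx]; positivity
  have hx1 : ∀ n, x n ≤ 1 := fun n => by
    simp only [hx]
    refine div_le_one_of_le₀ ?_ (by positivity)
    have h : (jacI y n : ℝ) ≤ n * y := Nat.floor_le (by positivity)
    have : (n : ℝ) * y ≤ n * 1 := by gcongr
    linarith
  have hxl : Filter.Tendsto x Filter.atTop (nhds y) := by
    have h := (tendsto_nat_floor_mul_div_atTop hy0).comp (tendsto_natCast_atTop_atTop (R := ℝ))
    refine h.congr fun n => ?_
    simp only [hx, jacI, Function.comp, mul_comm]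
  have hcl : Filter.Tendsto c Filter.atTop (nhds (b * (1 - y) - a * y)) :=
    ((hxl.const_sub 1).const_mul b).sub (hxl.const_mul a)
  have hinv : Filter.Tendsto (fun n : ℕ => ((n : ℝ))⁻¹) Filter.atTop (nhds 0) :=
    tendsto_inv_atTop_nhds_zero_nat
  have hpl : Filter.Tendsto p Filter.atTop (nhds y) := by
    have := hxl.add (hcl.mul hinv)
    rw [mul_zero, add_zero] at this
    exact this.congr fun n => by rw [hpx, div_eq_mul_inv]
  have c1 : Continuous (deriv f) := hf.continuous_deriv (by norm_num)
  have c2 : Continuous (deriv (deriv f)) :=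
    (hf.deriv' : ContDiff ℝ 2 (deriv f)).continuous_deriv (by norm_num)
  have hmain : Filter.Tendsto (fun n : ℕ => deriv f (x n) * c n
      + deriv (deriv f) (x n) / 2 * (p n * (1 - p n) + c n ^ 2 / n)) Filter.atTop
      (nhds (deriv f y * (b * (1 - y) - a * y)
        + deriv (deriv f) y / 2 * (y * (1 - y) + (b * (1 - y) - a * y) ^ 2 * 0))) := by
    refine (((c1.tendsto y).comp hxl).mul hcl).add
      ((((c2.tendsto y).comp hxl).div_const 2).mul
        ((hpl.mul (hpl.const_sub 1)).add ?_))
    simpa only [div_eq_mul_inv] using (hcl.pow 2).mul hinv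
  have herr : Filter.Tendsto (fun n : ℕ => n * binE n (p n) (fun j => f ((j : ℝ) / n) - f (x n))
      - (deriv f (x n) * c n
      + deriv (deriv f) (x n) / 2 * (p n * (1 - p n) + c n ^ 2 / n))) Filter.atTop (nhds 0) := by
    have hsq : Filter.Tendsto (fun n : ℕ =>
        M * (8 * (1 + (a + b) ^ 4) + (1 + (a + b) ^ 2)) / Real.sqrt n)
        Filter.atTop (nhds 0) :=
      Filter.Tendsto.const_div_atTop
        (Real.tendsto_sqrt_atTop.comp tendsto_natCast_atTop_atTop) _
    refine squeeze_zero_norm' ?_ hsq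
    filter_upwards [Filter.eventually_ge_atTop 1, Filter.eventually_ge_atTop ⌈a⌉₊,
      Filter.eventually_ge_atTop ⌈b⌉₊] with n hn hna hnb
    have hna' : a ≤ n := Nat.ceil_le.1 hna
    have hnb' : b ≤ n := Nat.ceil_le.1 hnb
    have hnp : (0 : ℝ) < n := by exact_mod_cast hn
    have ha1 : a / n ≤ 1 := (div_le_one hnp).2 hna'
    have hb1 : b / n ≤ 1 := (div_le_one hnp).2 hnb'
    have ha0 : 0 ≤ a / n := by positivity
    have hb0 : 0 ≤ b / n := by positivity
    have pe : p n = x n * (1 - a / n) + (1 - x n) * (b / n) := rfl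
    have X0 := hx0 n
    have X1 := hx1 n
    have p0 : 0 ≤ p n := by
      rw [pe]
      exact add_nonneg (mul_nonneg X0 (by linarith)) (mul_nonneg (by linarith) hb0)
    have p1 : p n ≤ 1 := by
      rw [pe]
      nlinarith [mul_nonneg X0 ha0, mul_nonneg (sub_nonneg.2 X1) (sub_nonneg.2 hb1)]
    refine main_bound f M hM0 hM n hn (p n) (x n) (c n) (a + b) p0 p1 (hpx n) ?_
    simp only [hc]
    rw [abs_le]
    constructor <;> nlinarith
  have := (herr.add hmain).const_mul θ
  refine (this.congr fun n => ?_).trans (le_of_eq ?_)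
  · simp only [binE, hp, hx]; ring
  · congr 1; ring
end

section
/- In the CIR–Wright–Fisher scheme, the conditional mean displacement converges: n·p_n − i_n → −a·z + b as n → ∞, where i_n = ⌊n^d·z⌋ and p_n = (i_n/n)(1 − a/n^d) + (1 − i_n/n)(b/n). -/
/-- Initial state `i_n = ⌊n^d·z⌋` of the CIR–Wright–Fisher chain. -/
noncomputable def cirI (d z : ℝ) (n : ℕ) : ℕ := ⌊(n : ℝ) ^ d * z⌋₊

/-- Expected fraction of A-types `p_n = (i_n/n)(1 − a/n^d) + (1 − i_n/n)(b/n)` in the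
Wright–Fisher model with mutation rates `α = a/n^d`, `β = b/n` and no selection. -/
noncomputable def cirP (a b d z : ℝ) (n : ℕ) : ℝ :=
  ((cirI d z n : ℝ) / n) * (1 - a / (n : ℝ) ^ d) + (1 - (cirI d z n : ℝ) / n) * (b / n)

/-- In the CIR–Wright–Fisher scheme, the conditional mean displacement
converges: `n·p_n − i_n → −a·z + b` as `n → ∞`, where `i_n = ⌊n^d·z⌋` and
`p_n = (i_n/n)(1 − a/n^d) + (1 − i_n/n)(b/n)`. -/
theorem stmt_14 (a b d z : ℝ) (ha : 0 < a) (hb : 0 < b)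
    (hd : d ∈ Set.Ioo (0 : ℝ) 1) (hz : 0 ≤ z) :
    Filter.Tendsto (fun n : ℕ => (n : ℝ) * cirP a b d z n - (cirI d z n : ℝ))
      Filter.atTop (nhds (-a * z + b)) := by
  have hx : Filter.Tendsto (fun n : ℕ => (n : ℝ) ^ d) Filter.atTop Filter.atTop :=
    (tendsto_rpow_atTop hd.1).comp tendsto_natCast_atTop_atTop
  have h1 : Filter.Tendsto (fun n : ℕ => (cirI d z n : ℝ) / (n : ℝ) ^ d)
      Filter.atTop (nhds z) := by
    have h := (tendsto_nat_floor_mul_div_atTop hz).comp hx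
    refine h.congr fun n => ?_
    simp only [Function.comp_apply, cirI, mul_comm]
  have h2 : Filter.Tendsto (fun n : ℕ => (n : ℝ) ^ (-(1 - d))) Filter.atTop (nhds 0) :=
    (tendsto_rpow_neg_atTop (by linarith [hd.2])).comp tendsto_natCast_atTop_atTop
  have h3 := ((h1.const_mul (-a)).add_const b).sub ((h1.mul h2).const_mul b)
  have e : -a * z + b - b * (z * 0) = -a * z + b := by ring
  rw [e] at h3
  refine h3.congr' ?_
  filter_upwards [Filter.eventually_gt_atTop 0] with n hn
  have hn' : (0 : ℝ) < n := by exact_mod_cast hn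
  have hp : (0 : ℝ) < (n : ℝ) ^ d := Real.rpow_pos_of_pos hn' d
  have e2 : (n : ℝ) ^ (-(1 - d)) = (n : ℝ) ^ d / n := by
    rw [show -(1 - d) = d - 1 by ring, Real.rpow_sub hn', Real.rpow_one]
  rw [e2, cirP]
  field_simp
  ring
end

section
/- In the CIR–Wright–Fisher scheme, the scaled conditional third moment vanishes in the limit: (1/n^{2d})·∑_{j=0}^{n} C(n,j)·p_n^j·(1−p_n)^{n−j}·(j − i_n)³ → 0 as n → ∞. -/
/-- Pascal-type recurrence for binomial sums. -/
theorem binom_sum_succ (p : ℝ) (f : ℕ → ℝ) (n : ℕ) :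
    ∑ j ∈ Finset.range (n + 2), ((n + 1).choose j : ℝ) * p ^ j * (1 - p) ^ (n + 1 - j) * f j
      = p * ∑ j ∈ Finset.range (n + 1), (n.choose j : ℝ) * p ^ j * (1 - p) ^ (n - j) * f (j + 1)
        + (1 - p) * ∑ j ∈ Finset.range (n + 1),
            (n.choose j : ℝ) * p ^ j * (1 - p) ^ (n - j) * f j := by
  have h2 : (1 - p) * ∑ j ∈ Finset.range (n + 1),
            (n.choose j : ℝ) * p ^ j * (1 - p) ^ (n - j) * f j
      = ∑ j ∈ Finset.range (n + 2),
            (n.choose j : ℝ) * p ^ j * (1 - p) ^ (n + 1 - j) * f j := by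
    rw [Finset.sum_range_succ _ (n + 1), Finset.mul_sum]
    simp only [Nat.choose_succ_self, Nat.cast_zero, zero_mul, add_zero]
    refine Finset.sum_congr rfl fun j hj => ?_
    have hj' : j ≤ n := by simpa [Nat.lt_succ_iff] using hj
    rw [Nat.succ_sub hj', pow_succ]
    ring
  rw [h2, Finset.sum_range_succ', Finset.sum_range_succ' _ (n + 1), Finset.mul_sum, ← add_assoc,
    ← Finset.sum_add_distrib]
  simp only [Nat.choose_zero_right]
  congr 1
  refine Finset.sum_congr rfl fun j hj => ?_
  rw [Nat.choose_succ_succ, Nat.add_sub_add_right]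
  push_cast
  ring

theorem binom_third (p : ℝ) (n : ℕ) : ∀ c : ℝ,
    ∑ j ∈ Finset.range (n + 1), (n.choose j : ℝ) * p ^ j * (1 - p) ^ (n - j) * ((j : ℝ) - c) ^ 3
      = n * p * (1 - p) * (1 - 2 * p) + 3 * (n * p * (1 - p)) * (n * p - c) + (n * p - c) ^ 3 := by
  induction n with
  | zero => intro c; simp
  | succ n ih =>
    intro c
    rw [binom_sum_succ p (fun j => ((j : ℝ) - c) ^ 3) n, ih c]
    have h := ih (c - 1)
    have e : ∀ j : ℕ, (((j + 1 : ℕ) : ℝ) - c) = (j : ℝ) - (c - 1) := fun j => by push_cast; ring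
    simp only [e]
    rw [h]
    push_cast
    ring

/-- In the CIR–Wright–Fisher scheme, the scaled conditional third moment
vanishes in the limit:
`(1/n^{2d})·∑_{j=0}^{n} C(n,j)·p_n^j·(1−p_n)^{n−j}·(j − i_n)³ → 0` as `n → ∞`. -/
theorem stmt_16 (a b d z : ℝ) (ha : 0 < a) (hb : 0 < b)
    (hd : d ∈ Set.Ioo (0 : ℝ) 1) (hz : 0 ≤ z) :
    Filter.Tendsto (fun n : ℕ =>
        (1 / (n : ℝ) ^ (2 * d)) * ∑ j ∈ Finset.range (n + 1),
          (n.choose j : ℝ) * (cirP a b d z n) ^ j * (1 - cirP a b d z n) ^ (n - j) *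
            ((j : ℝ) - (cirI d z n : ℝ)) ^ 3)
      Filter.atTop (nhds 0) := by
  obtain ⟨hd0, hd1⟩ := hd
  simp only [binom_third]
  have hx : Filter.Tendsto (fun n : ℕ => (n : ℝ) ^ d) Filter.atTop Filter.atTop :=
    (tendsto_rpow_atTop hd0).comp tendsto_natCast_atTop_atTop
  have hi : Filter.Tendsto (fun n : ℕ => (cirI d z n : ℝ) / (n : ℝ) ^ d) Filter.atTop (nhds z) := by
    have := (tendsto_nat_floor_mul_div_atTop hz).comp hx
    refine this.congr fun n => ?_
    simp [cirI, mul_comm]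
  have hxi : Filter.Tendsto (fun n : ℕ => ((n : ℝ) ^ d)⁻¹) Filter.atTop (nhds 0) :=
    tendsto_inv_atTop_zero.comp hx
  have hni : Filter.Tendsto (fun n : ℕ => ((n : ℝ))⁻¹) Filter.atTop (nhds 0) :=
    tendsto_inv_atTop_zero.comp tendsto_natCast_atTop_atTop
  have hxn : Filter.Tendsto (fun n : ℕ => (n : ℝ) ^ d / n) Filter.atTop (nhds 0) := by
    have h := (tendsto_rpow_neg_atTop (sub_pos.2 hd1)).comp
      (tendsto_natCast_atTop_atTop (R := ℝ))
    refine h.congr' ?_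
    filter_upwards [Filter.eventually_gt_atTop 0] with n hn
    have hn' : (0 : ℝ) < n := by exact_mod_cast hn
    simp only [Function.comp]
    rw [neg_sub, Real.rpow_sub_one hn'.ne']
  -- abbreviations
  set u : ℕ → ℝ := fun n => (cirI d z n : ℝ) / (n : ℝ) ^ d with hu
  set w : ℕ → ℝ := fun n => (n : ℝ) ^ d / n with hw
  set y : ℕ → ℝ := fun n => ((n : ℝ) ^ d)⁻¹ with hy
  set m : ℕ → ℝ := fun n => -(a * u n) + (1 - u n * w n) * b with hm
  have hmt : Filter.Tendsto m Filter.atTop (nhds (-(a * z) + (1 - z * 0) * b)) :=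
    (hi.const_mul a).neg.add (((hi.mul hxn).const_sub 1).mul_const b)
  set P : ℕ → ℝ := fun n => m n * (n : ℝ)⁻¹ + u n * w n with hP
  have hPt : Filter.Tendsto P Filter.atTop (nhds ((-(a * z) + (1 - z * 0) * b) * 0 + z * 0)) :=
    (hmt.mul hni).add (hi.mul hxn)
  -- (n p) / x^2
  set Q : ℕ → ℝ := fun n => m n * y n ^ 2 + u n * y n with hQ
  have hQt : Filter.Tendsto Q Filter.atTop
      (nhds ((-(a * z) + (1 - z * 0) * b) * 0 ^ 2 + z * 0)) :=
    (hmt.mul (hxi.pow 2)).add (hi.mul hxi)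
  have key : Filter.Tendsto (fun n => Q n * (1 - P n) * (1 - 2 * P n)
      + 3 * (Q n * (1 - P n)) * m n + y n ^ 2 * m n ^ 3) Filter.atTop (nhds 0) := by
    have h := (((hQt.mul (hPt.const_sub 1)).mul ((hPt.const_mul 2).const_sub 1)).add
      (((hQt.mul (hPt.const_sub 1)).const_mul 3).mul hmt)).add ((hxi.pow 2).mul (hmt.pow 3))
    convert h using 2
    ring
  refine key.congr' ?_
  filter_upwards [Filter.eventually_gt_atTop 0] with n hn
  have hn' : (0 : ℝ) < n := by exact_mod_cast hn
  have hxp : (0 : ℝ) < (n : ℝ) ^ d := Real.rpow_pos_of_pos hn' d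
  have e2 : (n : ℝ) ^ (2 * d) = ((n : ℝ) ^ d) ^ 2 := by
    rw [mul_comm, Real.rpow_mul hn'.le]; norm_cast
  have hpP : cirP a b d z n = P n := by
    simp only [cirP, hP, hm, hu, hw]
    field_simp
    ring
  have hm' : (n : ℝ) * P n - cirI d z n = m n := by
    simp only [hP, hu, hw]
    field_simp
    ring
  have hQ' : Q n = (n : ℝ) * P n * y n ^ 2 := by
    have : (n : ℝ) * P n = m n + cirI d z n := by linarith
    rw [this]
    simp only [hQ, hu, hy]
    field_simp
  rw [hpP, hm', e2, hQ']
  simp only [hy]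
  field_simp
end

section
/- Let f : ℝ → ℝ be three times continuously differentiable with compact support, θ > 0. Then for every z ≥ 0, (θ/a)·n^d·∑_{j=0}^{n} C(n,j)·p_n^j·(1−p_n)^{n−j}·( f(j/n^d) − f(i_n/n^d) ) → −θ·(z − b/a)·f′(z) + (1/2)·(θ/a)·z·f″(z) as n → ∞, the right-hand side being the CIR diffusion generator applied to f. -/
lemma binom_rec (p : ℝ) (n : ℕ) (g : ℕ → ℝ) :
    ∑ j ∈ Finset.range (n + 2), ((n + 1).choose j : ℝ) * p ^ j * (1 - p) ^ (n + 1 - j) * g j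
    = p * ∑ j ∈ Finset.range (n + 1), (n.choose j : ℝ) * p ^ j * (1 - p) ^ (n - j) * g (j + 1)
      + (1 - p) * ∑ j ∈ Finset.range (n + 1),
        (n.choose j : ℝ) * p ^ j * (1 - p) ^ (n - j) * g j := by
  have h2 : ∑ j ∈ Finset.range (n + 1), (n.choose j : ℝ) * p ^ j * (1 - p) ^ (n + 1 - j) * g j
      = (1 - p) * ∑ j ∈ Finset.range (n + 1),
        (n.choose j : ℝ) * p ^ j * (1 - p) ^ (n - j) * g j := by
    rw [Finset.mul_sum]
    refine Finset.sum_congr rfl fun j hj => ?_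
    have : n + 1 - j = (n - j) + 1 := by have := Finset.mem_range.1 hj; omega
    rw [this, pow_succ]; ring
  have h3 : ∑ j ∈ Finset.range (n + 2), (n.choose j : ℝ) * p ^ j * (1 - p) ^ (n + 1 - j) * g j
      = ∑ j ∈ Finset.range (n + 1), (n.choose j : ℝ) * p ^ j * (1 - p) ^ (n + 1 - j) * g j := by
    rw [Finset.sum_range_succ _ (n + 1)]; simp
  rw [← h2, ← h3, Finset.mul_sum, Finset.sum_range_succ' _ (n + 1),
    Finset.sum_range_succ' _ (n + 1), ← add_assoc, ← Finset.sum_add_distrib]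
  congr 1
  · refine Finset.sum_congr rfl fun j _ => ?_
    rw [Nat.choose_succ_succ, Nat.add_sub_add_right]; push_cast; ring
  · simp

lemma binom_moments (p : ℝ) (n : ℕ) : ∀ A B C D F : ℝ,
    ∑ j ∈ Finset.range (n + 1), (n.choose j : ℝ) * p ^ j * (1 - p) ^ (n - j) *
      (A + B * ((j : ℝ) - n * p) + C * ((j : ℝ) - n * p) ^ 2 + D * ((j : ℝ) - n * p) ^ 3
        + F * ((j : ℝ) - n * p) ^ 4)
    = A + C * (n * p * (1 - p)) + D * (n * p * (1 - p) * (1 - 2 * p))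
      + F * (3 * (n * p * (1 - p)) ^ 2 + n * p * (1 - p) * (1 - 6 * (p * (1 - p)))) := by
  induction n with
  | zero => intro A B C D F; simp
  | succ n ih =>
    intro A B C D F
    rw [binom_rec p n (fun j => A + B * ((j : ℝ) - (n + 1 : ℕ) * p)
        + C * ((j : ℝ) - (n + 1 : ℕ) * p) ^ 2 + D * ((j : ℝ) - (n + 1 : ℕ) * p) ^ 3
        + F * ((j : ℝ) - (n + 1 : ℕ) * p) ^ 4)]
    have e : ∀ t : ℝ, ∀ v : ℝ, A + B * (v + t) + C * (v + t) ^ 2 + D * (v + t) ^ 3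
        + F * (v + t) ^ 4 = (A + B * t + C * t ^ 2 + D * t ^ 3 + F * t ^ 4)
        + (B + 2 * C * t + 3 * D * t ^ 2 + 4 * F * t ^ 3) * v
        + (C + 3 * D * t + 6 * F * t ^ 2) * v ^ 2 + (D + 4 * F * t) * v ^ 3 + F * v ^ 4 := by
      intro t v; ring
    have e1 : ∀ j : ℕ, ((j + 1 : ℕ) : ℝ) - (n + 1 : ℕ) * p = ((j : ℝ) - n * p) + (1 - p) := by
      intro j; push_cast; ring
    have e2 : ∀ j : ℕ, (j : ℝ) - (n + 1 : ℕ) * p = ((j : ℝ) - n * p) + (-p) := by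
      intro j; push_cast; ring
    simp only [e1]
    simp only [e2]
    simp only [e]
    rw [ih, ih]
    push_cast
    ring

lemma taylor_bd (f : ℝ → ℝ) (hf : ContDiff ℝ 3 f) (hsupp : HasCompactSupport f) :
    ∃ M : ℝ, 0 ≤ M ∧ ∀ x y : ℝ,
      |f y - f x - deriv f x * (y - x) - deriv (deriv f) x / 2 * (y - x) ^ 2|
        ≤ M * |y - x| ^ 3 := by
  have h1 : ContDiff ℝ 2 (deriv f) := by
    have : ContDiff ℝ (2 + 1) f := by simpa [show (2 : WithTop ℕ∞) + 1 = 3 by norm_num] using hf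
    exact (contDiff_succ_iff_deriv.1 this).2.2
  have h2 : ContDiff ℝ 1 (deriv (deriv f)) := by
    have : ContDiff ℝ (1 + 1) (deriv f) := by
      simpa [show (1 : WithTop ℕ∞) + 1 = 2 by norm_num] using h1
    exact (contDiff_succ_iff_deriv.1 this).2.2
  have d0 : Differentiable ℝ f := hf.differentiable (by norm_num)
  have d1 : Differentiable ℝ (deriv f) := h1.differentiable (by norm_num)
  have d2 : Differentiable ℝ (deriv (deriv f)) := h2.differentiable (by norm_num)
  obtain ⟨M, hM⟩ := (h2.continuous_deriv le_rfl).bounded_above_of_compact_support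
    hsupp.deriv.deriv.deriv
  refine ⟨M, (norm_nonneg _).trans (hM 0), fun x y => ?_⟩
  have hM0 : 0 ≤ M := (norm_nonneg _).trans (hM 0)
  have hx : x ∈ Set.uIcc x y := Set.left_mem_uIcc
  have hy : y ∈ Set.uIcc x y := Set.right_mem_uIcc
  have hsub : ∀ t ∈ Set.uIcc x y, |t - x| ≤ |y - x| := fun t ht => Set.abs_sub_left_of_mem_uIcc ht
  have s1 : ∀ t, |deriv (deriv f) t - deriv (deriv f) x| ≤ M * |t - x| := fun t =>
    convex_univ.norm_image_sub_le_of_norm_deriv_le (f := deriv (deriv f)) (fun u _ => d2 u)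
      (fun u _ => hM u) (Set.mem_univ x) (Set.mem_univ t)
  have s2 : ∀ t ∈ Set.uIcc x y,
      |deriv f t - deriv f x - deriv (deriv f) x * (t - x)| ≤ M * |y - x| ^ 2 := by
    intro t ht
    have hd : ∀ u ∈ Set.uIcc x y, HasDerivWithinAt
        (fun t => deriv f t - deriv (deriv f) x * (t - x))
        (deriv (deriv f) u - deriv (deriv f) x) (Set.uIcc x y) u := by
      intro u _
      have := (d1 u).hasDerivAt.sub (((hasDerivAt_id u).sub_const x).const_mul
        (deriv (deriv f) x))
      refine HasDerivAt.hasDerivWithinAt ?_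
      refine this.congr_deriv ?_
      simp
    have := (convex_uIcc x y).norm_image_sub_le_of_norm_hasDerivWithin_le
      (C := M * |y - x|) hd (fun u hu => (s1 u).trans
        (mul_le_mul_of_nonneg_left (hsub u hu) hM0)) hx ht
    simp only [Real.norm_eq_abs, sub_self, mul_zero, sub_zero] at this
    calc _ = |deriv f t - deriv (deriv f) x * (t - x) - deriv f x| := by congr 1; ring
      _ ≤ _ := this
      _ ≤ M * |y - x| * |y - x| := mul_le_mul_of_nonneg_left (hsub t ht) (by positivity)
      _ = _ := by ring
  have hd : ∀ u ∈ Set.uIcc x y, HasDerivWithinAt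
      (fun t => f t - deriv f x * (t - x) - deriv (deriv f) x / 2 * (t - x) ^ 2)
      (deriv f u - deriv f x - deriv (deriv f) x * (u - x)) (Set.uIcc x y) u := by
    intro u _
    have k := (hasDerivAt_id u).sub_const x
    have := ((d0 u).hasDerivAt.sub (k.const_mul (deriv f x))).sub
      ((k.pow 2).const_mul (deriv (deriv f) x / 2))
    refine HasDerivAt.hasDerivWithinAt ?_
    refine this.congr_deriv ?_
    simp; ring
  have := (convex_uIcc x y).norm_image_sub_le_of_norm_hasDerivWithin_le
      (C := M * |y - x| ^ 2) hd (fun u hu => s2 u hu) hx hy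
  simp only [Real.norm_eq_abs, sub_self, mul_zero, sub_zero] at this
  calc _ = |f y - deriv f x * (y - x) - deriv (deriv f) x / 2 * (y - x) ^ 2
        - (f x - deriv (deriv f) x / 2 * 0 ^ 2)| := by congr 1; ring
    _ ≤ M * |y - x| ^ 2 * |y - x| := by simpa using this
    _ = _ := by ring

/-- The non-asymptotic estimate. -/
lemma main_bd (f : ℝ → ℝ) (M : ℝ) (hM0 : 0 ≤ M)
    (hM : ∀ x y : ℝ, |f y - f x - deriv f x * (y - x) - deriv (deriv f) x / 2 * (y - x) ^ 2|
        ≤ M * |y - x| ^ 3) (n : ℕ) (p i N c V : ℝ) (hp0 : 0 ≤ p) (hp1 : p ≤ 1) (hN : 0 < N)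
    (hc : c = n * p - i) (hV : V = n * p * (1 - p)) :
    |N * ∑ j ∈ Finset.range (n + 1), (n.choose j : ℝ) * p ^ j * (1 - p) ^ (n - j) *
        (f ((j : ℝ) / N) - f (i / N))
      - (deriv f (i / N) * c + deriv (deriv f) (i / N) / 2 * (V / N + c ^ 2 * N⁻¹))|
    ≤ M * (√N)⁻¹ * ((V / N + c ^ 2 * N⁻¹) + (3 * (V / N) ^ 2 + V / N * N⁻¹ * (1 - 6 * (p * (1 - p)))
      + 4 * c * (V / N) * N⁻¹ * (1 - 2 * p) + 6 * c ^ 2 * (V / N) * N⁻¹ + c ^ 4 * N⁻¹ ^ 2)) := by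
  set x := i / N with hx
  set w : ℕ → ℝ := fun j => (n.choose j : ℝ) * p ^ j * (1 - p) ^ (n - j) with hw
  have hw0 : ∀ j, 0 ≤ w j := fun j => by
    have : 0 ≤ 1 - p := by linarith
    simp only [hw]; positivity
  have hs : 0 < √N := Real.sqrt_pos.2 hN
  have hss : √N * √N = N := Real.mul_self_sqrt hN.le
  have hyx : ∀ j : ℕ, (j : ℝ) / N - x = ((j : ℝ) - n * p + c) / N := by
    intro j; rw [hx, hc]; ring
  have m := binom_moments p n
  -- main term
  have hmain : deriv f x * c + deriv (deriv f) x / 2 * (V / N + c ^ 2 * N⁻¹)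
      = N * ∑ j ∈ Finset.range (n + 1), w j * (deriv f x * ((j : ℝ) / N - x)
        + deriv (deriv f) x / 2 * ((j : ℝ) / N - x) ^ 2) := by
    have := m (deriv f x * c / N + deriv (deriv f) x / 2 * c ^ 2 / N ^ 2)
      (deriv f x / N + deriv (deriv f) x * c / N ^ 2) (deriv (deriv f) x / 2 / N ^ 2) 0 0
    rw [Finset.sum_congr rfl (g := fun j => w j * (deriv f x / N * c
      + deriv f x / N * ((j : ℝ) - n * p) + deriv (deriv f) x / 2 / N ^ 2 *
        ((j : ℝ) - n * p + c) ^ 2)) (fun j _ => by simp only [hw]; ring)] at this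
    rw [Finset.sum_congr rfl (g := fun j => w j * (deriv f x / N * c
      + deriv f x / N * ((j : ℝ) - n * p) + deriv (deriv f) x / 2 / N ^ 2 *
        ((j : ℝ) - n * p + c) ^ 2)) (fun j _ => by rw [hyx]; ring), this, ← hV]
    field_simp
    ring
  have hrem : ∑ j ∈ Finset.range (n + 1), w j * ((√N)⁻¹ * ((j : ℝ) / N - x) ^ 2
        + √N * ((j : ℝ) / N - x) ^ 4) * N
      = (√N)⁻¹ * ((V / N + c ^ 2 * N⁻¹) + (3 * (V / N) ^ 2
      + V / N * N⁻¹ * (1 - 6 * (p * (1 - p)))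
      + 4 * c * (V / N) * N⁻¹ * (1 - 2 * p) + 6 * c ^ 2 * (V / N) * N⁻¹ + c ^ 4 * N⁻¹ ^ 2)) := by
    have hsN : √N = (√N)⁻¹ * N := by field_simp; nlinarith
    have h := m ((√N)⁻¹ * (c ^ 2 / N + c ^ 4 / N ^ 2)) ((√N)⁻¹ * (2 * c / N + 4 * c ^ 3 / N ^ 2))
      ((√N)⁻¹ * (1 / N + 6 * c ^ 2 / N ^ 2)) ((√N)⁻¹ * (4 * c / N ^ 2)) ((√N)⁻¹ * (1 / N ^ 2))
    rw [← hV] at h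
    have key : ∀ v : ℝ, ((√N)⁻¹ * ((v + c) / N) ^ 2 + √N * ((v + c) / N) ^ 4) * N
        = (√N)⁻¹ * (c ^ 2 / N + c ^ 4 / N ^ 2) + (√N)⁻¹ * (2 * c / N + 4 * c ^ 3 / N ^ 2) * v
      + (√N)⁻¹ * (1 / N + 6 * c ^ 2 / N ^ 2) * v ^ 2 + (√N)⁻¹ * (4 * c / N ^ 2) * v ^ 3
      + (√N)⁻¹ * (1 / N ^ 2) * v ^ 4 := by
      intro v
      have : √N * ((v + c) / N) ^ 4 = (√N)⁻¹ * N * ((v + c) / N) ^ 4 := by rw [← hsN]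
      rw [this]
      field_simp
      ring
    calc _ = _ := Finset.sum_congr rfl (fun j _ => by rw [hyx, mul_assoc, key])
      _ = _ := h
      _ = _ := by field_simp; ring
  rw [hmain, ← mul_sub, ← Finset.sum_sub_distrib, abs_mul, abs_of_pos hN, mul_assoc M, ← hrem,
    Finset.mul_sum, mul_comm N]
  refine (mul_le_mul_of_nonneg_right (Finset.abs_sum_le_sum_abs _ _) hN.le).trans ?_
  rw [Finset.sum_mul]
  refine Finset.sum_le_sum fun j _ => ?_
  change |w j * (f ((j : ℝ) / N) - f x) - w j * _| * N ≤ _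
  rw [← mul_sub, abs_mul, abs_of_nonneg (hw0 j)]
  have hb : |(j : ℝ) / N - x| ^ 3 ≤ (√N)⁻¹ * ((j : ℝ) / N - x) ^ 2
      + √N * ((j : ℝ) / N - x) ^ 4 := by
    set v := (j : ℝ) / N - x
    have e2 : v ^ 2 = |v| ^ 2 := (sq_abs v).symm
    have e4 : v ^ 4 = |v| ^ 4 := by rw [show v ^ 4 = (v ^ 2) ^ 2 by ring, e2]; ring
    rw [e2, e4]
    have h0 : 0 ≤ |v| ^ 2 * ((√N)⁻¹ * (1 - √N * |v|) ^ 2 + |v|) := by positivity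
    have : |v| ^ 2 * ((√N)⁻¹ * (1 - √N * |v|) ^ 2 + |v|)
        = (√N)⁻¹ * |v| ^ 2 + √N * |v| ^ 4 - |v| ^ 3 := by field_simp; ring
    linarith
  have ht := (hM x ((j : ℝ) / N)).trans (mul_le_mul_of_nonneg_left hb hM0)
  rw [← sub_sub]
  calc _ ≤ w j * (M * ((√N)⁻¹ * ((j : ℝ) / N - x) ^ 2 + √N * ((j : ℝ) / N - x) ^ 4)) * N :=
        mul_le_mul_of_nonneg_right (mul_le_mul_of_nonneg_left ht (hw0 j)) hN.le
    _ = _ := by ring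

/-- Let `f : ℝ → ℝ` be three times continuously differentiable with
compact support, `θ > 0`. Then for every `z ≥ 0`,
`(θ/a)·n^d·∑_{j=0}^{n} C(n,j)·p_n^j·(1−p_n)^{n−j}·(f(j/n^d) − f(i_n/n^d))
  → −θ·(z − b/a)·f′(z) + (1/2)·(θ/a)·z·f″(z)` as `n → ∞`,
the right-hand side being the CIR diffusion generator applied to `f`. -/
theorem stmt_17 (a b θ d : ℝ) (ha : 0 < a) (hb : 0 < b) (hθ : 0 < θ)
    (hd : d ∈ Set.Ioo (0 : ℝ) 1)
    (f : ℝ → ℝ) (hf : ContDiff ℝ 3 f) (hsupp : HasCompactSupport f)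
    (z : ℝ) (hz : 0 ≤ z) :
    Filter.Tendsto (fun n : ℕ =>
        (θ / a) * (n : ℝ) ^ d * ∑ j ∈ Finset.range (n + 1),
          (n.choose j : ℝ) * (cirP a b d z n) ^ j * (1 - cirP a b d z n) ^ (n - j) *
            (f ((j : ℝ) / (n : ℝ) ^ d) - f ((cirI d z n : ℝ) / (n : ℝ) ^ d)))
      Filter.atTop
      (nhds (-θ * (z - b / a) * deriv f z + (1 / 2) * (θ / a) * z * deriv (deriv f) z)) := by
  obtain ⟨hd0, hd1⟩ := hd
  obtain ⟨M, hM0, hM⟩ := taylor_bd f hf hsupp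
  set N : ℕ → ℝ := fun n => (n : ℝ) ^ d with hNdef
  set p : ℕ → ℝ := fun n => cirP a b d z n with hpdef
  set i : ℕ → ℝ := fun n => (cirI d z n : ℝ) with hidef
  set c : ℕ → ℝ := fun n => n * p n - i n with hcdef
  set V : ℕ → ℝ := fun n => n * p n * (1 - p n) with hVdef
  have hNtop : Filter.Tendsto N Filter.atTop Filter.atTop :=
    (tendsto_rpow_atTop hd0).comp tendsto_natCast_atTop_atTop
  have hNinv : Filter.Tendsto (fun n => (N n)⁻¹) Filter.atTop (nhds 0) :=
    tendsto_inv_atTop_zero.comp hNtop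
  have hNn : Filter.Tendsto (fun n : ℕ => N n / n) Filter.atTop (nhds 0) := by
    have := (tendsto_rpow_neg_atTop (y := 1 - d) (by linarith)).comp
      (tendsto_natCast_atTop_atTop (R := ℝ))
    refine this.congr' ?_
    filter_upwards [Filter.eventually_gt_atTop 0] with n hn
    have : (0 : ℝ) < n := by exact_mod_cast hn
    simp only [Function.comp, hNdef]
    rw [neg_sub, Real.rpow_sub this, Real.rpow_one]
  have hx : Filter.Tendsto (fun n => i n / N n) Filter.atTop (nhds z) := by
    have := (tendsto_nat_floor_mul_div_atTop (R := ℝ) hz).comp hNtop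
    refine this.congr fun n => ?_
    simp only [Function.comp, hidef, cirI, hNdef, mul_comm]
  have hin : Filter.Tendsto (fun n : ℕ => i n / n) Filter.atTop (nhds 0) := by
    have := hx.mul hNn
    rw [mul_zero] at this
    refine this.congr' ?_
    filter_upwards [hNtop.eventually_gt_atTop 0] with n hn
    field_simp
  have hnp : ∀ᶠ n : ℕ in Filter.atTop,
      (n : ℝ) * p n = i n * (1 - a / N n) + (1 - i n / n) * b := by
    filter_upwards [Filter.eventually_gt_atTop 0] with n hn
    have : (0 : ℝ) < n := by exact_mod_cast hn
    simp only [hpdef, cirP, hidef, hNdef]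
    field_simp
  have hc : Filter.Tendsto c Filter.atTop (nhds (b - a * z)) := by
    have : Filter.Tendsto (fun n : ℕ => (1 - i n / n) * b - a * (i n / N n)) Filter.atTop
        (nhds ((1 - 0) * b - a * z)) :=
      ((hin.const_sub 1).mul_const b).sub (hx.const_mul a)
    rw [sub_zero, one_mul] at this
    refine this.congr' ?_
    filter_upwards [hnp] with n hn
    simp only [hcdef]
    rw [hn]; ring
  have hnpN : Filter.Tendsto (fun n : ℕ => n * p n / N n) Filter.atTop (nhds z) := by
    have := hx.add (hc.mul hNinv)
    rw [mul_zero, add_zero] at this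
    refine this.congr fun n => ?_
    simp only [hcdef]; ring
  have hp : Filter.Tendsto p Filter.atTop (nhds 0) := by
    have := hnpN.mul hNn
    rw [mul_zero] at this
    refine this.congr' ?_
    filter_upwards [hNtop.eventually_gt_atTop 0, Filter.eventually_gt_atTop 0] with n hn hn'
    have : (0 : ℝ) < n := by exact_mod_cast hn'
    field_simp
  have hV : Filter.Tendsto (fun n => V n / N n) Filter.atTop (nhds z) := by
    have := hnpN.mul (hp.const_sub 1)
    rw [sub_zero, mul_one] at this
    refine this.congr fun n => ?_
    simp only [hVdef]; ring
  have hp0 : ∀ᶠ n in Filter.atTop, 0 ≤ p n := by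
    filter_upwards [hnp, hNtop.eventually_ge_atTop a, hin.eventually_le_const zero_lt_one,
      Filter.eventually_gt_atTop 0] with n h1 h2 h3 h4
    have hn : (0 : ℝ) < n := by exact_mod_cast h4
    have h5 : a / N n ≤ 1 := (div_le_one (ha.trans_le h2)).2 h2
    have h6 : 0 ≤ i n := Nat.cast_nonneg _
    have h7 : 0 ≤ (n : ℝ) * p n := by
      rw [h1]
      exact add_nonneg (mul_nonneg h6 (by linarith)) (mul_nonneg (by linarith) hb.le)
    exact nonneg_of_mul_nonneg_right h7 hn
  have hp1 : ∀ᶠ n in Filter.atTop, p n ≤ 1 := hp.eventually_le_const zero_lt_one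
  have hsq : Filter.Tendsto (fun n => (√(N n))⁻¹) Filter.atTop (nhds 0) :=
    tendsto_inv_atTop_zero.comp (Real.tendsto_sqrt_atTop.comp hNtop)
  have hA : Filter.Tendsto (fun n => V n / N n + c n ^ 2 * (N n)⁻¹) Filter.atTop (nhds z) := by
    simpa using hV.add ((hc.pow 2).mul hNinv)
  have hpq := hp.mul (hp.const_sub 1)
  have hB := ((((((hV.pow 2).const_mul 3).add
    ((hV.mul hNinv).mul ((hpq.const_mul 6).const_sub 1))).add
    ((((hc.const_mul 4).mul hV).mul hNinv).mul ((hp.const_mul 2).const_sub 1))).add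
    ((((hc.pow 2).const_mul 6).mul hV).mul hNinv)).add ((hc.pow 4).mul (hNinv.pow 2)))
  have herr := (hsq.const_mul M).mul (hA.add hB)
  rw [mul_zero, zero_mul] at herr
  have h1c : Continuous (deriv f) := hf.continuous_deriv (by norm_num)
  have h2c : Continuous (deriv (deriv f)) := by
    have h1 : ContDiff ℝ 2 (deriv f) := by
      have : ContDiff ℝ (2 + 1) f := by simpa [show (2 : WithTop ℕ∞) + 1 = 3 by norm_num] using hf
      exact (contDiff_succ_iff_deriv.1 this).2.2
    exact h1.continuous_deriv (by norm_num)
  have hmain := (((h1c.tendsto z).comp hx).mul hc).add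
    ((((h2c.tendsto z).comp hx).div_const 2).mul hA)
  have hdiff := squeeze_zero_norm' (f := fun n : ℕ =>
      N n * ∑ j ∈ Finset.range (n + 1), (n.choose j : ℝ) * p n ^ j * (1 - p n) ^ (n - j) *
        (f ((j : ℝ) / N n) - f (i n / N n))
      - (deriv f (i n / N n) * c n
        + deriv (deriv f) (i n / N n) / 2 * (V n / N n + c n ^ 2 * (N n)⁻¹))) (by
    filter_upwards [hp0, hp1, hNtop.eventually_gt_atTop 0] with n q0 q1 q2
    exact main_bd f M hM0 hM n (p n) (i n) (N n) (c n) (V n) q0 q1 q2 rfl rfl) herr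
  have hfin := (hdiff.add hmain).const_mul (θ / a)
  have hlim : θ / a * (0 + (deriv f z * (b - a * z) + deriv (deriv f) z / 2 * z))
      = -θ * (z - b / a) * deriv f z + (1 / 2) * (θ / a) * z * deriv (deriv f) z := by
    field_simp
    ring
  rw [hlim] at hfin
  refine hfin.congr fun n => ?_
  simp only [Function.comp]
  ring
end
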